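/- (Properties of the perturbed densities in the lower bound construction.) Let c₀ be a probability density on [0,1]² with c₀(u,v) ≥ m > 0 for all (u,v), let j ∈ ℕ, let K_j ⊂ ℤ² be a finite index set with |K_j| = 2^{2j}, and let {ψ^ε_{ℓ,k} : ℓ ∈ ℕ, k ∈ ℤ², ε ∈ {1,2,3}} be a bivariate wavelet system forming an orthonormal family in L²([0,1]²) with ∫_{[0,1]²} ψ^ε_{ℓ,k} = 0. Let u > 0 satisfy u · sup_{(x,y)∈[0,1]²} Σ_{k∈K_j} Σ_{ε=1}^{3} |ψ^ε_{j,k}(x,y)| ≤ m, and for δ = (δ_k)_{k∈K_j} ∈ {−1,1}^{K_j} define c_δ = c₀ + Σ_{k∈K_j} Σ_{ε=1}^{3} δ_k u ψ^ε_{j,k}. Then: (i) every c_δ is a probability density on [0,1]²; (ii) ‖c_δ − c₀‖²_{L²([0,1]²)} = 3 · 2^{2j} u²; (iii) the wavelet coefficients of c_δ − c₀ are ∫ (c_δ − c₀) ψ^ε_{ℓ,k} = δ_k u for ℓ = j, k ∈ K_j, and 0 otherwise, so that if u = C₁ M 2^{−j(s+1)} with s > 0, p ≥ 1, M > 0 and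 3C₁^p ≤ 1, then for every level ℓ, Σ_{k} Σ_{ε} |∫ (c_δ − c₀) ψ^ε_{ℓ,k}|^p ≤ M^p 2^{−ℓ(s+1−2/p)p}, i.e. c_δ − c₀ belongs to the Besov ball b_{s,p,∞}(M). -/

import Mathlib

open MeasureTheory

noncomputable section

/-- The unit square `[0,1]² ⊆ ℝ²`. -/
def unitSq : Set (ℝ × ℝ) := Set.Icc (0 : ℝ) 1 ×ˢ Set.Icc (0 : ℝ) 1

/-- A bounded measurable function is integrable on the unit square. -/
theorem integrableOn_unitSq_of_bounded {f : ℝ × ℝ → ℝ} (hf : Measurable f) {C : ℝ}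
    (hC : ∀ z, |f z| ≤ C) : IntegrableOn f unitSq := by
  have hfin : volume unitSq < ⊤ := (isCompact_Icc.prod isCompact_Icc).measure_lt_top
  exact Measure.integrableOn_of_bounded (M := C) hfin.ne hf.aestronglyMeasurable
    (Filter.Eventually.of_forall fun z => by simpa using hC z)

/-- Integration on the unit square of a finite double linear combination. -/
theorem setIntegral_sum_sum_const_mul (K : Finset (ℤ × ℤ)) (a : ℤ × ℤ → ℝ)
    (f : ℤ × ℤ → Fin 3 → ℝ × ℝ → ℝ) (hf : ∀ k ε, IntegrableOn (f k ε) unitSq) :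
    ∫ z in unitSq, ∑ k ∈ K, ∑ ε : Fin 3, a k * f k ε z =
      ∑ k ∈ K, ∑ ε : Fin 3, a k * ∫ z in unitSq, f k ε z := by
  rw [integral_finsetSum _ fun k _ => integrable_finsetSum _ fun ε _ => (hf k ε).const_mul (a k)]
  refine Finset.sum_congr rfl fun k _ => ?_
  rw [integral_finsetSum _ fun ε _ => (hf k ε).const_mul (a k)]
  exact Finset.sum_congr rfl fun ε _ => integral_const_mul _ _

/-- **Properties of the perturbed densities in the lower bound construction.**
For `c_δ = c₀ + Σ_{k∈K_j} Σ_ε δ_k u ψ^ε_{j,k}` with Rademacher signs `δ_k` and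
`u·sup Σ|ψ^ε_{j,k}| ≤ m ≤ c₀`:
(i) `c_δ` is a probability density on `[0,1]²`;
(ii) `‖c_δ − c₀‖² = 3·2^{2j}u²`;
(iii) the wavelet coefficients of `c_δ − c₀` are `δ_k u` at level `j` for `k ∈ K_j` and `0`
otherwise, and if `u = C₁M2^{−j(s+1)}` with `3C₁^p ≤ 1` then `c_δ − c₀ ∈ b_{s,p,∞}(M)`. -/
theorem perturbed_density_properties
    (c₀ : ℝ × ℝ → ℝ) (m : ℝ) (hm : 0 < m)
    (hc₀meas : Measurable c₀) (hc₀pos : ∀ z, 0 ≤ c₀ z) (hc₀supp : ∀ z ∉ unitSq, c₀ z = 0)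
    (hc₀int : (∫ z in unitSq, c₀ z) = 1)
    (hc₀low : ∀ z ∈ unitSq, m ≤ c₀ z)
    (ψ : ℕ → ℤ × ℤ → Fin 3 → ℝ × ℝ → ℝ)
    (hψmeas : ∀ j k ε, Measurable (ψ j k ε))
    (hψbdd : ∀ j k ε, ∃ C : ℝ, ∀ z, |ψ j k ε z| ≤ C)
    (hψsupp : ∀ j k ε, ∀ z ∉ unitSq, ψ j k ε z = 0)
    (hψon : ∀ j k ε j' k' ε',
      (∫ z in unitSq, ψ j k ε z * ψ j' k' ε' z) =
        if (j, k, ε) = (j', k', ε') then 1 else 0)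
    (hψzero : ∀ j k ε, (∫ z in unitSq, ψ j k ε z) = 0)
    (j : ℕ) (Kj : Finset (ℤ × ℤ)) (hKj : (Kj.card : ℝ) = 2 ^ (2 * j))
    (u : ℝ) (hu : 0 < u)
    (husmall : ∀ z ∈ unitSq, u * ∑ k ∈ Kj, ∑ ε : Fin 3, |ψ j k ε z| ≤ m)
    (δ : ℤ × ℤ → ℝ) (hδ : ∀ k ∈ Kj, δ k = 1 ∨ δ k = -1)
    (cδ : ℝ × ℝ → ℝ)
    (hcδ : ∀ z, cδ z = c₀ z + ∑ k ∈ Kj, ∑ ε : Fin 3, δ k * u * ψ j k ε z) :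
    -- (i) c_δ is a probability density on [0,1]²
    ((∀ z, 0 ≤ cδ z) ∧ (∀ z ∉ unitSq, cδ z = 0) ∧ (∫ z in unitSq, cδ z) = 1) ∧
    -- (ii) squared L² distance
    ((∫ z in unitSq, (cδ z - c₀ z) ^ 2) = 3 * 2 ^ (2 * j) * u ^ 2) ∧
    -- (iii) wavelet coefficients and Besov membership
    ((∀ (ℓ : ℕ) (k : ℤ × ℤ) (ε : Fin 3),
        (∫ z in unitSq, (cδ z - c₀ z) * ψ ℓ k ε z) =
          if ℓ = j ∧ k ∈ Kj then δ k * u else 0) ∧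
      ∀ (s p M C₁ : ℝ), 0 < s → 1 ≤ p → 0 < M → 0 < C₁ →
        u = C₁ * M * (2 : ℝ) ^ (-(j : ℝ) * (s + 1)) → 3 * C₁ ^ p ≤ 1 →
        ∀ ℓ : ℕ, (∑' k : ℤ × ℤ, ∑ ε : Fin 3,
            |∫ z in unitSq, (cδ z - c₀ z) * ψ ℓ k ε z| ^ p) ≤
          M ^ p * (2 : ℝ) ^ (-(ℓ : ℝ) * (s + 1 - 2 / p) * p)) := by
  have hint : ∀ ℓ k ε, IntegrableOn (ψ ℓ k ε) unitSq := fun ℓ k ε =>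
    (hψbdd ℓ k ε).elim fun C hC => integrableOn_unitSq_of_bounded (hψmeas ℓ k ε) hC
  have hintmul : ∀ ℓ k ε ℓ' k' ε',
      IntegrableOn (fun z => ψ ℓ k ε z * ψ ℓ' k' ε' z) unitSq := by
    intro ℓ k ε ℓ' k' ε'
    obtain ⟨C, hC⟩ := hψbdd ℓ k ε
    obtain ⟨C', hC'⟩ := hψbdd ℓ' k' ε'
    refine integrableOn_unitSq_of_bounded ((hψmeas ℓ k ε).mul (hψmeas ℓ' k' ε'))
      (C := C * C') fun z => ?_
    rw [abs_mul]
    exact mul_le_mul (hC z) (hC' z) (abs_nonneg _) ((abs_nonneg _).trans (hC z))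
  have habs : ∀ k ∈ Kj, |δ k| = 1 := fun k hk => by
    rcases hδ k hk with h | h <;> simp [h]
  have hd : ∀ z, cδ z - c₀ z = ∑ k ∈ Kj, ∑ ε : Fin 3, δ k * u * ψ j k ε z := fun z => by
    rw [hcδ z, add_sub_cancel_left]
  have hcoef : ∀ (ℓ : ℕ) (k : ℤ × ℤ) (ε : Fin 3),
      (∫ z in unitSq, (cδ z - c₀ z) * ψ ℓ k ε z) = if ℓ = j ∧ k ∈ Kj then δ k * u else 0 := by
    intro ℓ k ε
    have hfun : ∀ z, (cδ z - c₀ z) * ψ ℓ k ε z =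
        ∑ k' ∈ Kj, ∑ ε' : Fin 3, δ k' * u * (ψ j k' ε' z * ψ ℓ k ε z) := fun z => by
      rw [hd z, Finset.sum_mul]
      refine Finset.sum_congr rfl fun k' _ => ?_
      rw [Finset.sum_mul]
      exact Finset.sum_congr rfl fun ε' _ => by ring
    simp_rw [hfun]
    rw [setIntegral_sum_sum_const_mul Kj (fun k' => δ k' * u)
      (fun k' ε' z => ψ j k' ε' z * ψ ℓ k ε z) fun k' ε' => hintmul j k' ε' ℓ k ε]
    simp_rw [hψon]
    by_cases hℓ : ℓ = j
    · subst hℓ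
      have hsum : ∀ k' : ℤ × ℤ, (∑ ε' : Fin 3,
          δ k' * u * (if (ℓ, k', ε') = (ℓ, k, ε) then (1 : ℝ) else 0)) =
          if k' = k then δ k' * u else 0 := fun k' => by
        by_cases hk : k' = k <;> simp [hk]
      rw [Finset.sum_congr rfl fun k' _ => hsum k']
      simp
    · simp [hℓ, Ne.symm hℓ]
  refine ⟨⟨?_, ?_, ?_⟩, ?_, hcoef, ?_⟩
  · intro z
    by_cases hz : z ∈ unitSq
    · have hle : |∑ k ∈ Kj, ∑ ε : Fin 3, δ k * u * ψ j k ε z| ≤ m := by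
        refine le_trans ?_ (husmall z hz)
        rw [Finset.mul_sum]
        refine (Finset.abs_sum_le_sum_abs _ _).trans (Finset.sum_le_sum fun k hk => ?_)
        rw [Finset.mul_sum]
        refine (Finset.abs_sum_le_sum_abs _ _).trans (Finset.sum_le_sum fun ε _ => ?_)
        rw [abs_mul, abs_mul, habs k hk, abs_of_pos hu, one_mul]
      rw [hcδ z]
      linarith [neg_le_of_abs_le hle, hc₀low z hz]
    · simp [hcδ z, hc₀supp z hz, hψsupp _ _ _ z hz]
  · intro z hz
    simp [hcδ z, hc₀supp z hz, hψsupp _ _ _ z hz]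
  · have hc₀ : IntegrableOn c₀ unitSq :=
      not_imp_comm.1 integral_undef (by rw [hc₀int]; exact one_ne_zero)
    simp_rw [hcδ]
    rw [integral_add hc₀ (integrable_finsetSum _ fun k _ => integrable_finsetSum _ fun ε _ =>
        (hint j k ε).const_mul _),
      setIntegral_sum_sum_const_mul Kj (fun k => δ k * u) (ψ j) (hint j), hc₀int]
    simp [hψzero]
  · have hdmul : ∀ k ε, IntegrableOn (fun z => (cδ z - c₀ z) * ψ j k ε z) unitSq := by
      intro k ε
      simp_rw [hd, Finset.sum_mul, mul_assoc]
      exact integrable_finsetSum _ fun k' _ => integrable_finsetSum _ fun ε' _ =>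
        ((hintmul j k' ε' j k ε).const_mul u).const_mul (δ k')
    have hfun : ∀ z, (cδ z - c₀ z) ^ 2 =
        ∑ k ∈ Kj, ∑ ε : Fin 3, δ k * u * ((cδ z - c₀ z) * ψ j k ε z) := fun z => by
      rw [sq]
      nth_rewrite 2 [hd z]
      simp_rw [Finset.mul_sum]
      exact Finset.sum_congr rfl fun k _ => Finset.sum_congr rfl fun ε _ => by ring
    simp_rw [hfun]
    rw [setIntegral_sum_sum_const_mul Kj (fun k => δ k * u)
      (fun k ε z => (cδ z - c₀ z) * ψ j k ε z) hdmul]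
    have hterm : ∀ k ∈ Kj, (∑ ε : Fin 3,
        δ k * u * ∫ z in unitSq, (cδ z - c₀ z) * ψ j k ε z) = 3 * u ^ 2 := by
      intro k hk
      have hsq : δ k ^ 2 = 1 := by rw [← sq_abs, habs k hk, one_pow]
      simp only [hcoef, hk, and_self, if_true, Finset.sum_const, Finset.card_univ,
        Fintype.card_fin, nsmul_eq_mul, Nat.cast_ofNat]
      linear_combination 3 * u ^ 2 * hsq
    rw [Finset.sum_congr rfl hterm, Finset.sum_const, nsmul_eq_mul, hKj]
    ring
  · intro s p M C₁ _ hp hM hC₁ hu_eq hC₁p ℓ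
    have hp0 : p ≠ 0 := by positivity
    simp_rw [hcoef]
    by_cases hℓ : ℓ = j
    · subst hℓ
      have hterm : ∀ k : ℤ × ℤ, (∑ _ε : Fin 3,
          |if ℓ = ℓ ∧ k ∈ Kj then δ k * u else 0| ^ p) = if k ∈ Kj then 3 * u ^ p else 0 := by
        intro k
        by_cases hk : k ∈ Kj
        · simp [hk, abs_mul, habs k hk, abs_of_pos hu]
        · simp [hk, Real.zero_rpow hp0]
      have hpow : (2 : ℝ) ^ (2 * ℓ) = (2 : ℝ) ^ (2 * (ℓ : ℝ)) := by
        rw [← Real.rpow_natCast]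
        push_cast
        rfl
      have hup : u ^ p = C₁ ^ p * M ^ p * (2 : ℝ) ^ (-(ℓ : ℝ) * (s + 1) * p) := by
        rw [hu_eq, Real.mul_rpow (by positivity) (by positivity), Real.mul_rpow hC₁.le hM.le,
          ← Real.rpow_mul zero_le_two]
      have hexp : -(ℓ : ℝ) * (s + 1 - 2 / p) * p = 2 * (ℓ : ℝ) + -(ℓ : ℝ) * (s + 1) * p := by
        field_simp
        ring
      rw [tsum_congr hterm]
      rw [tsum_eq_sum (s := Kj) fun k hk => if_neg hk,
        Finset.sum_congr rfl fun k hk => if_pos hk, Finset.sum_const, nsmul_eq_mul, hKj, hpow,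
        hup, hexp, Real.rpow_add two_pos]
      have hnn : 0 ≤ M ^ p * ((2 : ℝ) ^ (2 * (ℓ : ℝ)) * (2 : ℝ) ^ (-(ℓ : ℝ) * (s + 1) * p)) := by
        positivity
      calc _ = 3 * C₁ ^ p *
            (M ^ p * ((2 : ℝ) ^ (2 * (ℓ : ℝ)) * (2 : ℝ) ^ (-(ℓ : ℝ) * (s + 1) * p))) := by ring
        _ ≤ _ := mul_le_of_le_one_left hnn hC₁p
    · simp only [hℓ, false_and, if_false, abs_zero, Real.zero_rpow hp0, Finset.sum_const_zero,
        tsum_zero]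
      positivity
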